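/- Let (X, ρ) be a metric space, Y = {−1,+1}, Z = Y × X, and let A be a learning algorithm whose output A_s : X → Y is a classification rule, with loss of the form l(A_s, z) = f(z_y, A_s(z_x)). For a classification rule Δ and x ∈ X, define the distance D(x, Δ) = inf{ c ≥ 0 : ∃ x' ∈ X with ρ(x, x') ≤ c and Δ(x) ≠ Δ(x') }. Fix γ > 0 and n̂ ≤ n, and suppose that for the training set s = ((y_1,x_1),…,(y_n,x_n)) at least n̂ training samples satisfy D(x_i, A_s) > γ. If X admits a finite γ/2-cover of cardinality N, then A is (2N, 0, n̂) pseudo robust: Z can be partitioned into 2N disjoint sets and there is a subset ŝ of the training samples with |ŝ| = n̂ such that whenever s_j ∈ ŝ and z ∈ Z lie in a common set of the partition, l(A_s, s_j) = l(A_s, z). -/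

import Mathlib

open scoped Classical

/-- The label set `Y = {−1, +1}` (as a subtype of `ℤ`). -/
def Lbl : Type := {y : ℤ // y = -1 ∨ y = 1}

/-- The distance of a point `x` to a classification rule `Δ`:
`D(x, Δ) = inf{c ≥ 0 : ∃ x', ρ(x, x') ≤ c and Δ(x) ≠ Δ(x')}`. -/
noncomputable def ruleDist {X : Type*} [MetricSpace X]
    (Δ : X → Lbl) (x : X) : ℝ :=
  sInf {c : ℝ | 0 ≤ c ∧ ∃ x' : X, dist x x' ≤ c ∧ Δ x ≠ Δ x'}

/-- A classification rule is constant on every ball around `x` of radius below `ruleDist Δ x`. -/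
theorem eq_of_dist_lt_ruleDist {X : Type*} [MetricSpace X] {Δ : X → Lbl} {x x' : X}
    (h : dist x x' < ruleDist Δ x) : Δ x = Δ x' := by
  by_contra hne
  have hle : ruleDist Δ x ≤ dist x x' :=
    csInf_le ⟨0, fun _ hc => hc.1⟩ ⟨dist_nonneg, x', le_rfl, hne⟩
  exact absurd h hle.not_gt

/-- The encoding of the two labels by `Fin 2`. -/
noncomputable def Lbl.toFin (y : Lbl) : Fin 2 := if y.1 = 1 then 1 else 0

theorem Lbl.toFin_injective : Function.Injective Lbl.toFin := by
  rintro ⟨a, rfl | rfl⟩ ⟨b, rfl | rfl⟩ h <;> first | rfl | simp [Lbl.toFin] at h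

/-- **Large-margin classifiers are pseudo robust.**
If at least `n̂` of the training samples are at distance more than `γ` from the
decision boundary of the learned rule `A_s`, and `X` has a finite `γ/2`-cover
of cardinality `N`, then `A` is `(2N, 0, n̂)` pseudo robust: `Z = Y × X` can be
partitioned into `2N` disjoint sets and there is a subset `ŝ` of `n̂` training
samples such that whenever `s_j ∈ ŝ` and `z` lie in a common set, the losses
`l(A_s, z) = f(z_y, A_s(z_x))` agree exactly. -/
theorem large_margin_pseudo_robust
    {X : Type*} [MetricSpace X]
    (n : ℕ) (A : (Fin n → Lbl × X) → X → Lbl)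
    (f : Lbl → Lbl → ℝ)
    (γ : ℝ) (hγ : 0 < γ) (nhat : ℕ) (hnhat : nhat ≤ n)
    (s : Fin n → Lbl × X)
    (hmargin : nhat ≤
      (Finset.univ.filter fun i : Fin n => γ < ruleDist (A s) ((s i).2)).card)
    (N : ℕ) (cov : Fin N → X)
    (hcov : ∀ x : X, ∃ i, dist x (cov i) ≤ γ / 2) :
    ∃ D : Fin (2 * N) → Set (Lbl × X),
      Pairwise (Function.onFun Disjoint D) ∧
      (⋃ i, D i) = Set.univ ∧
      ∃ S : Finset (Fin n), S.card = nhat ∧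
        ∀ j ∈ S, ∀ (z : Lbl × X) (i : Fin (2 * N)),
          s j ∈ D i → z ∈ D i →
            f (s j).1 (A s ((s j).2)) = f z.1 (A s z.2) := by
  choose cell hcell using hcov
  let idx : Lbl × X → Fin (2 * N) := fun z => finProdFinEquiv (z.1.toFin, cell z.2)
  obtain ⟨S, hS, hcard⟩ := Finset.exists_subset_card_eq hmargin
  refine ⟨fun i => idx ⁻¹' {i}, fun i j hij => ?_, ?_, S, hcard, fun j hj z i hji hzi => ?_⟩
  · exact Disjoint.preimage _ (Set.disjoint_singleton.2 hij)
  · exact Set.eq_univ_of_forall fun z => Set.mem_iUnion.2 ⟨idx z, rfl⟩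
  · have hidx : idx (s j) = idx z := Eq.trans hji (Eq.symm hzi)
    obtain ⟨hlbl, hcl⟩ := Prod.ext_iff.1 (finProdFinEquiv.injective hidx)
    have hclose : dist (s j).2 z.2 ≤ γ := by
      have h₁ := hcell (s j).2
      have h₂ := hcell z.2
      rw [← show cell (s j).2 = cell z.2 from hcl] at h₂
      linarith [dist_triangle_right (s j).2 z.2 (cov (cell (s j).2))]
    have hfar := (Finset.mem_filter.1 (hS hj)).2
    rw [Lbl.toFin_injective hlbl, eq_of_dist_lt_ruleDist (hclose.trans_lt hfar)]
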